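/- arXiv:2005.13142 — 4 statements merged into one kernel-verified Lean document; each statement's English description precedes it below -/
import Mathlib

section
/- For every N ∈ ℕ the set 𝓘_N = {α ∈ ℕ³ : α₃ ≤ 1, |α| ≤ N} has exactly (N+1)² elements, and the functions {Ω ↦ Ω^α : α ∈ 𝓘_N}, viewed as real-valued functions on the unit sphere S², are linearly independent; hence their linear span is a space of dimension (N+1)². -/
open MeasureTheory

noncomputable section

/-- The unit sphere `S² ⊂ ℝ³`. -/
abbrev Sph : Set (EuclideanSpace ℝ (Fin 3)) := Metric.sphere 0 1

/-- The monomial `Ω^α = Ω₁^{α₁} Ω₂^{α₂} Ω₃^{α₃}`. -/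
def mono (α : Fin 3 → ℕ) (Ω : EuclideanSpace ℝ (Fin 3)) : ℝ := ∏ i, Ω i ^ α i

/-- The reduced index set `𝓘_N = {α ∈ ℕ³ : α₃ ≤ 1, |α| ≤ N}`. -/
def redIdx (N : ℕ) : Set (Fin 3 → ℕ) := {α : Fin 3 → ℕ | α 2 ≤ 1 ∧ ∑ i, α i ≤ N}

/-- A bijection from `ℕ × ℕ` onto the triples with last entry at most one: pairs `i ≤ j` give last
entry `0`, pairs `j < i` give last entry `1`. -/
def pairToTriple (p : ℕ × ℕ) : Fin 3 → ℕ :=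
  if p.1 ≤ p.2 then ![p.1, p.2 - p.1, 0] else ![p.2, p.1 - p.2 - 1, 1]

lemma pairToTriple_injective : Function.Injective pairToTriple := by
  rintro ⟨i, j⟩ ⟨k, l⟩ h
  have h0 := congrFun h 0
  have h1 := congrFun h 1
  have h2 := congrFun h 2
  simp only [pairToTriple] at h0 h1 h2
  split_ifs at h0 h1 h2 <;> simp at h0 h1 h2 <;> ext <;> simp <;> omega

lemma redIdx_eq_image (N : ℕ) :
    redIdx N =
      pairToTriple '' (Finset.range (N + 1) ×ˢ Finset.range (N + 1) : Finset (ℕ × ℕ)) := by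
  ext α
  simp only [redIdx, Set.mem_ofPred_eq, Fin.sum_univ_three, Set.mem_image, Finset.mem_coe,
    Finset.mem_product, Finset.mem_range, Prod.exists]
  constructor
  · rintro ⟨h2, hN⟩
    obtain h | h : α 2 = 0 ∨ α 2 = 1 := by omega
    · refine ⟨α 0, α 0 + α 1, by omega, ?_⟩
      ext i
      fin_cases i <;> simp [pairToTriple, h]
    · refine ⟨α 0 + α 1 + 1, α 0, by omega, ?_⟩
      have hle : ¬ α 0 + α 1 + 1 ≤ α 0 := by omega
      ext i
      fin_cases i <;> simp [pairToTriple, h, hle]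
      omega
  · rintro ⟨i, j, hij, rfl⟩
    by_cases h : i ≤ j
    · simp [pairToTriple, h]; omega
    · simp [pairToTriple, h]; omega

lemma redIdx_finite (N : ℕ) : (redIdx N).Finite := by
  rw [redIdx_eq_image]
  exact (Finset.finite_toSet _).image _

lemma ncard_redIdx (N : ℕ) : (redIdx N).ncard = (N + 1) ^ 2 := by
  rw [redIdx_eq_image, Set.ncard_image_of_injective _ pairToTriple_injective,
    Set.ncard_coe_finset]
  simp [sq]

/-- The first two exponents of a multi-index. -/
def planarExponent (α : Fin 3 → ℕ) : Fin 2 →₀ ℕ := Finsupp.equivFunOnFinite.symm ![α 0, α 1]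

lemma eq_of_planarExponent_eq {α β : Fin 3 → ℕ} (h : planarExponent α = planarExponent β)
    (h2 : α 2 = β 2) : α = β := by
  have h0 := DFunLike.congr_fun h 0
  have h1 := DFunLike.congr_fun h 1
  simp only [planarExponent, Finsupp.equivFunOnFinite_symm_apply_apply, Matrix.cons_val_zero,
    Matrix.cons_val_one] at h0 h1
  ext i
  fin_cases i <;> assumption

/-- The coefficient of `Ω₃ ^ k` in `∑ g α Ω^α`, as a polynomial in `Ω₁` and `Ω₂`. -/
def planarPart {ι : Type*} (e : ι → Fin 3 → ℕ) (s : Finset ι) (g : ι → ℝ) (k : ℕ) :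
    MvPolynomial (Fin 2) ℝ :=
  ∑ i ∈ s, MvPolynomial.monomial (planarExponent (e i)) (if e i 2 = k then g i else 0)

lemma coeff_planarPart {ι : Type*} {e : ι → Fin 3 → ℕ} (he : Function.Injective e)
    {s : Finset ι} (g : ι → ℝ) {i : ι} (hi : i ∈ s) :
    (planarPart e s g (e i 2)).coeff (planarExponent (e i)) = g i := by
  classical
  rw [planarPart, MvPolynomial.coeff_sum, Finset.sum_eq_single i]
  · simp
  · intro j _ hj
    rw [MvPolynomial.coeff_monomial]
    split_ifs with h h2
    · exact absurd (he (eq_of_planarExponent_eq h h2)) hj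
    · rfl
    · rfl
  · exact fun h => absurd hi h

lemma sum_mono_eq_eval {ι : Type*} {e : ι → Fin 3 → ℕ} (he : ∀ i, e i 2 ≤ 1)
    (s : Finset ι) (g : ι → ℝ) (Ω : EuclideanSpace ℝ (Fin 3)) :
    ∑ i ∈ s, g i * mono (e i) Ω =
      MvPolynomial.eval ![Ω 0, Ω 1] (planarPart e s g 0) +
        Ω 2 * MvPolynomial.eval ![Ω 0, Ω 1] (planarPart e s g 1) := by
  simp only [planarPart, map_sum, Finset.mul_sum, ← Finset.sum_add_distrib]
  refine Finset.sum_congr rfl fun i _ => ?_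
  obtain h | h : e i 2 = 0 ∨ e i 2 = 1 := by have := he i; omega
  all_goals
    simp [h, mono, Fin.prod_univ_three, MvPolynomial.eval_monomial, planarExponent,
      Finsupp.prod_fintype]
  ring

lemma planarPart_eq_zero {ι : Type*} {e : ι → Fin 3 → ℕ} (he : ∀ i, e i 2 ≤ 1)
    {s : Finset ι} {g : ι → ℝ} (h : ∀ Ω ∈ Sph, ∑ i ∈ s, g i * mono (e i) Ω = 0)
    {k : ℕ} (hk : k ≤ 1) : planarPart e s g k = 0 := by
  refine MvPolynomial.funext_set (fun _ => Set.Icc (0 : ℝ) (1 / 2))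
    (fun _ => Set.Icc_infinite (by norm_num)) fun x hx => ?_
  have h0 : 0 ≤ x 0 ∧ x 0 ≤ 1 / 2 := hx 0 trivial
  have h1 : 0 ≤ x 1 ∧ x 1 ≤ 1 / 2 := hx 1 trivial
  have hpos : 0 < 1 - x 0 ^ 2 - x 1 ^ 2 := by nlinarith
  set z := √(1 - x 0 ^ 2 - x 1 ^ 2)
  have hz : 0 < z := Real.sqrt_pos.2 hpos
  have hz2 : z ^ 2 = 1 - x 0 ^ 2 - x 1 ^ 2 := Real.sq_sqrt hpos.le
  have key (w : ℝ) (hw : w ^ 2 = z ^ 2) :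
      MvPolynomial.eval x (planarPart e s g 0) +
        w * MvPolynomial.eval x (planarPart e s g 1) = 0 := by
    have hmem : (!₂[x 0, x 1, w] : EuclideanSpace ℝ (Fin 3)) ∈ Sph := by
      rw [mem_sphere_zero_iff_norm, EuclideanSpace.norm_eq, Real.sqrt_eq_one]
      simp [Fin.sum_univ_three]
      linarith
    have hx2 : ![x 0, x 1] = x := by
      ext i
      fin_cases i <;> rfl
    simpa [sum_mono_eq_eval he, hx2] using h _ hmem
  have hplus := key z rfl
  have hminus := key (-z) (neg_sq z)
  rw [map_zero]
  obtain rfl | rfl : k = 0 ∨ k = 1 := by omega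
  · linarith
  · exact (mul_eq_zero.1 (by linarith : z * _ = 0)).resolve_left hz.ne'

lemma linearIndependent_mono {ι : Type*} {e : ι → Fin 3 → ℕ} (he : Function.Injective e)
    (he2 : ∀ i, e i 2 ≤ 1) : LinearIndependent ℝ (fun i => fun Ω : Sph => mono (e i) Ω) := by
  rw [linearIndependent_iff']
  intro s g hg i hi
  rw [← coeff_planarPart he g hi, planarPart_eq_zero he2 ?_ (he2 i), MvPolynomial.coeff_zero]
  intro Ω hΩ
  simpa [Finset.sum_apply] using congrFun hg ⟨Ω, hΩ⟩

/-- `𝓘_N` has exactly `(N+1)²` elements, the functions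
`{Ω ↦ Ω^α : α ∈ 𝓘_N}` on `S²` are linearly independent, and hence their span has
dimension `(N+1)²`. -/
theorem card_and_linearIndependent_reduced (N : ℕ) :
    (redIdx N).ncard = (N + 1) ^ 2 ∧
    LinearIndependent ℝ (fun α : redIdx N => fun Ω : Sph => mono α.1 Ω) ∧
    Module.finrank ℝ
        (Submodule.span ℝ ((fun β : Fin 3 → ℕ => fun Ω : Sph => mono β Ω) '' redIdx N))
      = (N + 1) ^ 2 := by
  have hli : LinearIndependent ℝ (fun α : redIdx N => fun Ω : Sph => mono α.1 Ω) :=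
    linearIndependent_mono Subtype.val_injective fun α => α.2.1
  refine ⟨ncard_redIdx N, hli, ?_⟩
  have := (redIdx_finite N).fintype
  rw [Set.image_eq_range, finrank_span_eq_card hli, ← Nat.card_eq_fintype_card,
    Nat.card_coe_set_eq, ncard_redIdx]
end
end

section
/- (Divergence transformation under rotation.) Let R ∈ SO(3) and k ∈ ℕ, and let G_k and G_{k+1} be the unique matrices, indexed by multi-indices of order k and k+1 respectively, with (Rω)^γ = Σ_{|δ|=|γ|} (G_{|γ|})_{γδ} ω^δ for all ω ∈ ℝ³. Suppose E_δ : ℝ³ → ℝ is differentiable for every δ ∈ ℕ³ with |δ| = k+1, and define, for each γ with |γ| = k+1, the rotated field Ē_γ : ℝ³ → ℝ by Ē_γ(Rx) = Σ_{|δ|=k+1} (G_{k+1})_{γδ} E_δ(x). Then for every α with |α| = k and every x ∈ ℝ³, Σ_{d=1}^{3} (∂Ē_{α+e_d}/∂x_d)(Rx) = Σ_{|β|=k} (G_k)_{αβ} Σ_{l=1}^{3} (∂E_{β+e_l}/∂x_l)(x). -/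
open Matrix

noncomputable section

/-- The monomial `ω^α = ω₁^{α₁} ω₂^{α₂} ω₃^{α₃}` on `ℝ³`. -/
def monoP (α : Fin 3 → ℕ) (ω : Fin 3 → ℝ) : ℝ := ∏ i, ω i ^ α i

/-- The finite set of multi-indices of order `k`. -/
def idx (k : ℕ) : Finset (Fin 3 → ℕ) := Finset.Nat.antidiagonalTuple 3 k

theorem mem_idx {k : ℕ} {α : Fin 3 → ℕ} : α ∈ idx k ↔ ∑ i, α i = k :=
  Finset.Nat.mem_antidiagonalTuple

theorem monoP_add_single (α : Fin 3 → ℕ) (d : Fin 3) (ω : Fin 3 → ℝ) :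
    monoP (α + Pi.single d 1) ω = ω d * monoP α ω := by
  simp only [monoP, Pi.add_apply, pow_add, Finset.prod_mul_distrib]
  rw [mul_comm, Finset.prod_eq_single d (fun i _ hi => by simp [hi]) (by simp)]
  simp

theorem sum_add_single (α : Fin 3 → ℕ) (d : Fin 3) :
    ∑ i, (α + Pi.single d 1 : Fin 3 → ℕ) i = ∑ i, α i + 1 := by
  simp [Finset.sum_add_distrib]

/-- A relation between monomial functions persists when the monomials are replaced by arbitrary
scalars, since distinct monomials are linearly independent. -/
theorem sum_mul_eq_of_sum_mul_monoP_eq {ι κ : Type*} (s : Finset ι) (t : Finset κ)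
    (a : ι → ℝ) (b : κ → ℝ) (f : ι → Fin 3 → ℕ) (g : κ → Fin 3 → ℕ)
    (h : ∀ ω : Fin 3 → ℝ, ∑ i ∈ s, a i * monoP (f i) ω = ∑ j ∈ t, b j * monoP (g j) ω)
    (F : (Fin 3 → ℕ) → ℝ) :
    ∑ i ∈ s, a i * F (f i) = ∑ j ∈ t, b j * F (g j) := by
  let e : (Fin 3 → ℕ) → (Fin 3 →₀ ℕ) := Finsupp.equivFunOnFinite.symm
  let B := MvPolynomial.basisMonomials (Fin 3) ℝ
  have hB (α : Fin 3 → ℕ) (ω : Fin 3 → ℝ) : MvPolynomial.eval ω (B (e α)) = monoP α ω := by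
    simp [B, e, monoP, MvPolynomial.eval_monomial, Finsupp.prod_fintype]
  have hp : ∑ i ∈ s, a i • B (e (f i)) = ∑ j ∈ t, b j • B (e (g j)) := by
    refine MvPolynomial.funext fun ω => ?_
    simpa only [map_sum, MvPolynomial.smul_eval, hB] using h ω
  simpa [map_sum, Module.Basis.constr_basis, e] using
    congrArg (B.constr ℝ fun m => F m) hp

/-- Contracting the degree `k + 1` representation with an orthogonal matrix in one index
gives the degree `k` representation. -/
theorem sum_sum_mul_eq_of_orthogonal {R : Matrix (Fin 3) (Fin 3) ℝ} (hR : Rᵀ * R = 1) {k : ℕ}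
    {Gk Gk1 : (Fin 3 → ℕ) → (Fin 3 → ℕ) → ℝ}
    (hGk : ∀ ω : Fin 3 → ℝ, ∀ γ : Fin 3 → ℕ, ∑ i, γ i = k →
      monoP γ (R *ᵥ ω) = ∑ δ ∈ idx k, Gk γ δ * monoP δ ω)
    (hGk1 : ∀ ω : Fin 3 → ℝ, ∀ γ : Fin 3 → ℕ, ∑ i, γ i = k + 1 →
      monoP γ (R *ᵥ ω) = ∑ δ ∈ idx (k + 1), Gk1 γ δ * monoP δ ω)
    {α : Fin 3 → ℕ} (hα : ∑ i, α i = k) (l : Fin 3) (F : (Fin 3 → ℕ) → ℝ) :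
    ∑ d, ∑ δ ∈ idx (k + 1), R d l * Gk1 (α + Pi.single d 1) δ * F δ
      = ∑ β ∈ idx k, Gk α β * F (β + Pi.single l 1) := by
  rw [← Finset.sum_product']
  refine sum_mul_eq_of_sum_mul_monoP_eq _ _
    (fun p : Fin 3 × (Fin 3 → ℕ) => R p.1 l * Gk1 (α + Pi.single p.1 1) p.2) _ Prod.snd _
    (fun ω => ?_) F
  have hω : ∑ d, R d l * (R *ᵥ ω) d = ω l := by
    change (Rᵀ *ᵥ (R *ᵥ ω)) l = ω l
    rw [Matrix.mulVec_mulVec, hR, Matrix.one_mulVec]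
  calc ∑ p ∈ Finset.univ ×ˢ idx (k + 1),
        R p.1 l * Gk1 (α + Pi.single p.1 1) p.2 * monoP p.2 ω
      = ∑ d, R d l * monoP (α + Pi.single d 1) (R *ᵥ ω) := by
        rw [Finset.sum_product]
        refine Finset.sum_congr rfl fun d _ => ?_
        rw [hGk1 ω _ (by rw [sum_add_single, hα]), Finset.mul_sum]
        simp only [mul_assoc]
    _ = ω l * monoP α (R *ᵥ ω) := by
        simp only [monoP_add_single, ← mul_assoc, ← Finset.sum_mul, hω]
    _ = ∑ β ∈ idx k, Gk α β * monoP (β + Pi.single l 1) ω := by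
        rw [hGk ω α hα, Finset.mul_sum]
        refine Finset.sum_congr rfl fun β _ => ?_
        rw [monoP_add_single]
        ring

/-- divergence transformation under rotation: with `G_k`, `G_{k+1}` the
matrices representing `R ∈ SO(3)` on monomials of degree `k` and `k+1`, `E_δ`
differentiable fields for `|δ| = k+1`, and `Ē_γ(Rx) = Σ_{|δ|=k+1} (G_{k+1})_{γδ} E_δ(x)`,
one has `Σ_d ∂Ē_{α+e_d}/∂x_d (Rx) = Σ_{|β|=k} (G_k)_{αβ} Σ_l ∂E_{β+e_l}/∂x_l (x)`
for every `α` with `|α| = k` and every `x`. -/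
theorem divergence_rotation (R : Matrix (Fin 3) (Fin 3) ℝ)
    (hR : R ∈ Matrix.specialOrthogonalGroup (Fin 3) ℝ) (k : ℕ)
    (Gk Gk1 : (Fin 3 → ℕ) → (Fin 3 → ℕ) → ℝ)
    (hGk : ∀ ω : Fin 3 → ℝ, ∀ γ : Fin 3 → ℕ, ∑ i, γ i = k →
      monoP γ (R *ᵥ ω) = ∑ δ ∈ idx k, Gk γ δ * monoP δ ω)
    (hGk1 : ∀ ω : Fin 3 → ℝ, ∀ γ : Fin 3 → ℕ, ∑ i, γ i = k + 1 →
      monoP γ (R *ᵥ ω) = ∑ δ ∈ idx (k + 1), Gk1 γ δ * monoP δ ω)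
    (E Ebar : (Fin 3 → ℕ) → (Fin 3 → ℝ) → ℝ)
    (hE : ∀ δ : Fin 3 → ℕ, ∑ i, δ i = k + 1 → Differentiable ℝ (E δ))
    (hEbar : ∀ γ : Fin 3 → ℕ, ∑ i, γ i = k + 1 → ∀ x : Fin 3 → ℝ,
      Ebar γ (R *ᵥ x) = ∑ δ ∈ idx (k + 1), Gk1 γ δ * E δ x)
    (α : Fin 3 → ℕ) (hα : ∑ i, α i = k) (x : Fin 3 → ℝ) :
    ∑ d : Fin 3, fderiv ℝ (Ebar (α + Pi.single d 1)) (R *ᵥ x) (Pi.single d 1)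
      = ∑ β ∈ idx k, Gk α β *
          ∑ l : Fin 3, fderiv ℝ (E (β + Pi.single l 1)) x (Pi.single l 1) := by
  have hO := (Matrix.mem_orthogonalGroup_iff' _ _).mp (Matrix.mem_specialOrthogonalGroup_iff.mp hR).1
  have hO' := (Matrix.mem_orthogonalGroup_iff _ _).mp (Matrix.mem_specialOrthogonalGroup_iff.mp hR).1
  let L : (Fin 3 → ℝ) →L[ℝ] (Fin 3 → ℝ) := LinearMap.toContinuousLinearMap Rᵀ.mulVecLin
  have hL (v : Fin 3 → ℝ) : L v = Rᵀ *ᵥ v := rfl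
  have hLx : L (R *ᵥ x) = x := by rw [hL, Matrix.mulVec_mulVec, hO, Matrix.one_mulVec]
  have hLs (d : Fin 3) : L (Pi.single d 1) = ∑ l, R d l • (Pi.single l 1 : Fin 3 → ℝ) := by
    ext i
    simp [hL, Finset.sum_apply, Pi.single_apply]
  have hderiv (γ : Fin 3 → ℕ) (hγ : ∑ i, γ i = k + 1) (d : Fin 3) :
      fderiv ℝ (Ebar γ) (R *ᵥ x) (Pi.single d 1)
        = ∑ l, ∑ δ ∈ idx (k + 1), R d l * Gk1 γ δ * fderiv ℝ (E δ) x (Pi.single l 1) := by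
    have hfun : Ebar γ = fun y => ∑ δ ∈ idx (k + 1), Gk1 γ δ * E δ (L y) := by
      funext y
      rw [← hEbar γ hγ, hL, Matrix.mulVec_mulVec, hO', Matrix.one_mulVec]
    have hd : HasFDerivAt (Ebar γ)
        (∑ δ ∈ idx (k + 1), Gk1 γ δ • (fderiv ℝ (E δ) x).comp L) (R *ᵥ x) := by
      rw [hfun]
      refine HasFDerivAt.fun_sum fun δ hδ => HasFDerivAt.const_mul ?_ _
      refine HasFDerivAt.comp (R *ᵥ x) (g := E δ) ?_ L.hasFDerivAt
      rw [hLx]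
      exact (hE δ (mem_idx.mp hδ) x).hasFDerivAt
    rw [hd.fderiv, Finset.sum_comm]
    simp only [_root_.sum_apply, _root_.smul_apply,
      ContinuousLinearMap.comp_apply, hLs, map_sum, map_smul, smul_eq_mul, Finset.mul_sum]
    refine Finset.sum_congr rfl fun δ _ => Finset.sum_congr rfl fun l _ => ?_
    ring
  simp only [fun d => hderiv (α + Pi.single d 1) (by rw [sum_add_single, hα]) d]
  rw [Finset.sum_comm]
  simp only [Finset.mul_sum]
  rw [Finset.sum_comm (s := idx k)]
  exact Finset.sum_congr rfl fun l _ =>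
    sum_sum_mul_eq_of_orthogonal hO hGk hGk1 hα l fun δ => fderiv ℝ (E δ) x (Pi.single l 1)
end
end

section
/- Let E₀ > 0 and E₁ ∈ ℝ³ with 0 < ‖E₁‖ < E₀, set t = ‖E₁‖/E₀, and define c₀ = ((−2 + √(4 − 3t²))/t) · (E₁/‖E₁‖). Then ‖c₀‖ < 1 and −4c₀/(3 + ‖c₀‖²) = E₁/E₀; that is, c₀ is the solution of the M₁ consistency relation with ‖c₀‖ < 1. -/
noncomputable section

/-- The 3D M₁ closure parameter
`c₀ = ((−2 + √(4 − 3t²))/t) · (E₁/‖E₁‖)` with `t = ‖E₁‖/E₀`. -/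
def cZero (E0 : ℝ) (E1 : EuclideanSpace ℝ (Fin 3)) : EuclideanSpace ℝ (Fin 3) :=
  ((-2 + Real.sqrt (4 - 3 * (‖E1‖ / E0) ^ 2)) / (‖E1‖ / E0)) • (‖E1‖⁻¹ • E1)

/-- The scalar `k = (-2 + √(4 - 3t²))/t` satisfies `|k| < 1` and `-4k = t(3 + k²)`. -/
theorem abs_lt_one_and_consistency_of_scalar {t : ℝ} (ht : 0 < t) (ht1 : t < 1) :
    |(-2 + Real.sqrt (4 - 3 * t ^ 2)) / t| < 1 ∧
    -4 * ((-2 + Real.sqrt (4 - 3 * t ^ 2)) / t) =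
      t * (3 + ((-2 + Real.sqrt (4 - 3 * t ^ 2)) / t) ^ 2) := by
  have hs : Real.sqrt (4 - 3 * t ^ 2) ^ 2 = 4 - 3 * t ^ 2 := Real.sq_sqrt (by nlinarith)
  have hs0 := Real.sqrt_nonneg (4 - 3 * t ^ 2)
  set s := Real.sqrt (4 - 3 * t ^ 2)
  constructor
  · rw [abs_lt, lt_div_iff₀ ht, div_lt_iff₀ ht]
    constructor <;> nlinarith
  · field_simp
    linear_combination -hs

/-- for `E₀ > 0` and `0 < ‖E₁‖ < E₀`, the parameter `c₀` satisfies
`‖c₀‖ < 1` and the M₁ consistency relation `−4c₀/(3 + ‖c₀‖²) = E₁/E₀`. -/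
theorem cZero_lt_one_and_consistency (E0 : ℝ) (E1 : EuclideanSpace ℝ (Fin 3))
    (hE0 : 0 < E0) (h1 : 0 < ‖E1‖) (h2 : ‖E1‖ < E0) :
    ‖cZero E0 E1‖ < 1 ∧
    (-4 / (3 + ‖cZero E0 E1‖ ^ 2)) • cZero E0 E1 = E0⁻¹ • E1 := by
  obtain ⟨hk, hkt⟩ :=
    abs_lt_one_and_consistency_of_scalar (div_pos h1 hE0) ((div_lt_one hE0).2 h2)
  have hnorm : ‖cZero E0 E1‖ =
      |(-2 + Real.sqrt (4 - 3 * (‖E1‖ / E0) ^ 2)) / (‖E1‖ / E0)| := by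
    rw [cZero, norm_smul, norm_smul, norm_inv, norm_norm, inv_mul_cancel₀ h1.ne', mul_one,
      Real.norm_eq_abs]
  rw [hnorm, sq_abs]
  refine ⟨hk, ?_⟩
  rw [cZero, smul_smul, smul_smul]
  congr 1
  set k := (-2 + Real.sqrt (4 - 3 * (‖E1‖ / E0) ^ 2)) / (‖E1‖ / E0)
  have h3 : 3 + k ^ 2 ≠ 0 := by positivity
  rw [div_mul_eq_mul_div, hkt, mul_div_cancel_right₀ _ h3]
  field_simp
end
end

section
/- (Global hyperbolicity of the 3D HMPN system, matrix form.) Let Λ be a real symmetric positive definite n×n matrix, let M₁, M₂, M₃ be real symmetric n×n matrices, let D be an invertible real n×n matrix, and let c > 0. Assume that for every unit vector n = (n₁, n₂, n₃) ∈ S² and every ξ ∈ ℝⁿ, |ξᵀ (n₁M₁ + n₂M₂ + n₃M₃) ξ| ≤ ξᵀ Λ ξ. Then for every unit vector n ∈ S², the matrix A = c · D⁻¹ Λ⁻¹ (n₁M₁ + n₂M₂ + n₃M₃) D is diagonalizable over ℝ and all of its eigenvalues λ satisfy |λ| ≤ c. -/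
open Matrix RealInnerProductSpace

noncomputable section

open scoped MatrixOrder Matrix.Norms.L2Operator in
/-- A positive definite and a symmetric matrix are simultaneously diagonalized by a congruence. -/
theorem exists_congruence_one_diagonal {n : Type*} [Fintype n] [DecidableEq n]
    {Λ M : Matrix n n ℝ} (hΛ : Λ.PosDef) (hM : M.IsSymm) :
    ∃ (Q : Matrix n n ℝ) (d : n → ℝ), Qᵀ * Λ * Q = 1 ∧ Qᵀ * M * Q = diagonal d := by
  obtain ⟨B, rfl⟩ := CStarAlgebra.nonneg_iff_eq_star_mul_self.mp hΛ.posSemidef.nonneg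
  have hB : IsUnit B := isUnit_of_mul_isUnit_right hΛ.isUnit
  have hBdet : IsUnit B.det := (isUnit_iff_isUnit_det B).mp hB
  have hN : (B⁻¹ᵀ * M * B⁻¹).IsHermitian := by
    simp [IsHermitian, conjTranspose_eq_transpose_of_trivial, transpose_mul, hM.eq, mul_assoc]
  set U : Matrix n n ℝ := hN.eigenvectorUnitary.1
  have hU : Uᵀ * U = 1 := by
    have h := Unitary.coe_star_mul_self hN.eigenvectorUnitary
    simpa [star_eq_conjTranspose, conjTranspose_eq_transpose_of_trivial] using h
  refine ⟨B⁻¹ * U, hN.eigenvalues, ?_, ?_⟩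
  · calc (B⁻¹ * U)ᵀ * (star B * B) * (B⁻¹ * U)
        = Uᵀ * (B * B⁻¹)ᵀ * (B * B⁻¹) * U := by
          simp only [transpose_mul, star_eq_conjTranspose,
            conjTranspose_eq_transpose_of_trivial, mul_assoc]
      _ = 1 := by simp [mul_nonsing_inv B hBdet, hU]
  · have h := hN.conjStarAlgAut_star_eigenvectorUnitary
    rw [Unitary.conjStarAlgAut_apply] at h
    simpa [star_eq_conjTranspose, conjTranspose_eq_transpose_of_trivial, mul_assoc,
      Function.comp_def, U] using h

/-- global hyperbolicity of the 3D HMPN system, matrix form: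
let `Λ` be symmetric positive definite, `M₁, M₂, M₃` symmetric, `D` invertible and
`c > 0`; if `|ξᵀ(n₁M₁+n₂M₂+n₃M₃)ξ| ≤ ξᵀΛξ` for every unit vector `n ∈ S²` and all
`ξ`, then for every unit `n` the matrix `A = c D⁻¹ Λ⁻¹ (n₁M₁+n₂M₂+n₃M₃) D` is
diagonalizable over `ℝ` and all of its eigenvalues `λ` satisfy `|λ| ≤ c`. -/
theorem HMPN_global_hyperbolicity (n : ℕ)
    (Λ M1 M2 M3 D : Matrix (Fin n) (Fin n) ℝ)
    (hΛpd : Λ.PosDef) (h1 : M1.IsSymm) (h2 : M2.IsSymm) (h3 : M3.IsSymm)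
    (hD : IsUnit D) (c : ℝ) (hc : 0 < c)
    (hbound : ∀ nv : EuclideanSpace ℝ (Fin 3), ‖nv‖ = 1 → ∀ ξ : Fin n → ℝ,
      |ξ ⬝ᵥ (nv 0 • M1 + nv 1 • M2 + nv 2 • M3).mulVec ξ| ≤ ξ ⬝ᵥ Λ.mulVec ξ) :
    ∀ nv : EuclideanSpace ℝ (Fin 3), ‖nv‖ = 1 →
      (∃ (P : Matrix (Fin n) (Fin n) ℝ) (d : Fin n → ℝ),
        IsUnit P ∧
          P⁻¹ * (c • (D⁻¹ * (Λ⁻¹ * (nv 0 • M1 + nv 1 • M2 + nv 2 • M3)) * D)) * P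
            = Matrix.diagonal d) ∧
      ∀ t ∈ spectrum ℝ (c • (D⁻¹ * (Λ⁻¹ * (nv 0 • M1 + nv 1 • M2 + nv 2 • M3)) * D)),
        |t| ≤ c := by
  intro nv hnv
  have hM : (nv 0 • M1 + nv 1 • M2 + nv 2 • M3).IsSymm :=
    ((h1.smul _).add (h2.smul _)).add (h3.smul _)
  have hb := hbound nv hnv
  generalize nv 0 • M1 + nv 1 • M2 + nv 2 • M3 = M at hM hb ⊢
  obtain ⟨Q, d, hQΛ, hQM⟩ := exists_congruence_one_diagonal hΛpd hM
  have hQ : IsUnit Q := IsUnit.of_mul_eq_one_right _ hQΛ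
  have hΛinv : Λ⁻¹ = Q * Qᵀ := by
    refine inv_eq_left_inv ?_
    have h : Q * (Qᵀ * Λ) = 1 := mul_eq_one_comm.mp hQΛ
    rwa [← mul_assoc] at h
  have hDdet : IsUnit D.det := (isUnit_iff_isUnit_det D).mp hD
  have hQdet : IsUnit Q.det := (isUnit_iff_isUnit_det Q).mp hQ
  have hP : IsUnit (D⁻¹ * Q) := ((isUnit_nonsing_inv_iff).mpr hD).mul hQ
  have hdiag : (D⁻¹ * Q)⁻¹ * (c • (D⁻¹ * (Λ⁻¹ * M) * D)) * (D⁻¹ * Q)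
      = diagonal (c • d) := by
    calc (D⁻¹ * Q)⁻¹ * (c • (D⁻¹ * (Λ⁻¹ * M) * D)) * (D⁻¹ * Q)
        = c • (Q⁻¹ * (D * D⁻¹) * (Q * Qᵀ) * M * (D * D⁻¹) * Q) := by
          rw [Matrix.mul_inv_rev, nonsing_inv_nonsing_inv D hDdet, hΛinv]
          simp only [Matrix.mul_smul, Matrix.smul_mul, mul_assoc]
      _ = c • ((Q⁻¹ * Q) * (Qᵀ * M * Q)) := by
          simp only [mul_nonsing_inv D hDdet, mul_one, mul_assoc]
      _ = diagonal (c • d) := by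
          rw [nonsing_inv_mul Q hQdet, one_mul, hQM, diagonal_smul]
  refine ⟨⟨D⁻¹ * Q, c • d, hP, hdiag⟩, fun t ht => ?_⟩
  have hd (i : Fin n) : |d i| ≤ 1 := by
    have hform (N : Matrix (Fin n) (Fin n) ℝ) :
        Q.col i ⬝ᵥ N *ᵥ Q.col i = (Qᵀ * N * Q) i i := by
      rw [mul_assoc]
      rfl
    have h := hb (Q.col i)
    rwa [hform, hform, hQΛ, hQM, diagonal_apply_eq, one_apply_eq] at h
  have hspec := spectrum.units_conjugate' (R := ℝ) (a := c • (D⁻¹ * (Λ⁻¹ * M) * D)) (u := hP.unit)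
  rw [coe_units_inv, IsUnit.unit_spec, hdiag, spectrum_diagonal] at hspec
  rw [← hspec] at ht
  obtain ⟨i, rfl⟩ := ht
  rw [Pi.smul_apply, smul_eq_mul, abs_mul, abs_of_pos hc]
  exact mul_le_of_le_one_right hc.le (hd i)
end
end
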